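/- Let (A,B) be a left weak AB context in an abelian category C and set ω := A ∩ B. Then: (a) ω = A ∩ A^⊥ and ω^∧ = B; (b) (A,B) is an A^∧-cotorsion pair in C with id_A(B) = 0. -/

import Mathlib

/-!
Common definitions for Auslander–Buchweitz approximation theory in abelian
categories, following Becerril–Mendoza–Pérez–Santiago.
-/

open CategoryTheory CategoryTheory.Limits ZeroObject

universe w v u

namespace ABFormal

variable {C : Type u} [Category.{v} C] [Abelian C] [CategoryTheory.HasExt.{w} C]

/-- `0 → A → B → C' → 0` is a short exact sequence in `C`. -/
def IsShortExactSeq {A B C' : C} (f : A ⟶ B) (g : B ⟶ C') : Prop :=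
  ∃ w : f ≫ g = 0, (ShortComplex.mk f g w).ShortExact

/-- `ωω` is `XX`-injective: `Ext^i(X, W) = 0` for all `X ∈ XX`, `W ∈ ωω` and `i > 0`. -/
def IsRelInjective (XX ωω : Set C) : Prop :=
  ∀ W ∈ ωω, ∀ X ∈ XX, ∀ i : ℕ, 0 < i → Subsingleton (Abelian.Ext.{w} X W i)

/-- `ωω` is `XX`-projective: `Ext^i(W, X) = 0` for all `X ∈ XX`, `W ∈ ωω` and `i > 0`. -/
def IsRelProjective (XX ωω : Set C) : Prop :=
  ∀ W ∈ ωω, ∀ X ∈ XX, ∀ i : ℕ, 0 < i → Subsingleton (Abelian.Ext.{w} W X i)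

/-- `ωω` is a relative cogenerator in `XX`. -/
def IsRelCogenerator (XX ωω : Set C) : Prop :=
  ωω ⊆ XX ∧ ∀ X ∈ XX, ∃ (W X' : C) (i : X ⟶ W) (p : W ⟶ X'),
    W ∈ ωω ∧ X' ∈ XX ∧ IsShortExactSeq i p

/-- `ωω` is a relative generator in `XX`. -/
def IsRelGenerator (XX ωω : Set C) : Prop :=
  ωω ⊆ XX ∧ ∀ X ∈ XX, ∃ (X' W : C) (i : X' ⟶ W) (p : W ⟶ X),
    W ∈ ωω ∧ X' ∈ XX ∧ IsShortExactSeq i p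

/-- `id_XX(M) ≤ n` : `Ext^j(X, M) = 0` for all `X ∈ XX` and `j > n`. -/
def relInjDimLE (XX : Set C) (M : C) (n : ℕ) : Prop :=
  ∀ X ∈ XX, ∀ j : ℕ, n < j → Subsingleton (Abelian.Ext.{w} X M j)

/-- The relative injective dimension `id_XX(M) : ℕ∞`. -/
noncomputable def relInjDim (XX : Set C) (M : C) : ℕ∞ :=
  sInf {m : ℕ∞ | ∃ n : ℕ, m = (n : ℕ∞) ∧ relInjDimLE XX M n}

/-- `pd_XX(M) ≤ n` : `Ext^j(M, X) = 0` for all `X ∈ XX` and `j > n`. -/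
def relProjDimLE (XX : Set C) (M : C) (n : ℕ) : Prop :=
  ∀ X ∈ XX, ∀ j : ℕ, n < j → Subsingleton (Abelian.Ext.{w} M X j)

/-- The relative projective dimension `pd_XX(M) : ℕ∞`. -/
noncomputable def relProjDim (XX : Set C) (M : C) : ℕ∞ :=
  sInf {m : ℕ∞ | ∃ n : ℕ, m = (n : ℕ∞) ∧ relProjDimLE XX M n}

/-- There is an exact sequence `0 → X_n → ⋯ → X_0 → M → 0` with all `X_i ∈ XX`
(a resolution of length `n`). -/
inductive HasResolutionLength (XX : Set C) : ℕ → C → Prop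
  | zero {M X : C} (hX : X ∈ XX) (e : X ≅ M) : HasResolutionLength XX 0 M
  | succ {n : ℕ} {M : C} (K X : C) (hX : X ∈ XX)
      (i : K ⟶ X) (p : X ⟶ M) (hse : IsShortExactSeq i p)
      (hK : HasResolutionLength XX n K) : HasResolutionLength XX (n + 1) M

/-- The `XX`-resolution dimension `resdim_XX(M) : ℕ∞`. -/
noncomputable def resDim (XX : Set C) (M : C) : ℕ∞ :=
  sInf {m : ℕ∞ | ∃ n : ℕ, m = (n : ℕ∞) ∧ HasResolutionLength XX n M}

/-- `XX^∧`, the class of objects with a finite `XX`-resolution. -/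
def resHat (XX : Set C) : Set C :=
  {M | ∃ n : ℕ, HasResolutionLength XX n M}

/-- There is an exact sequence `0 → M → X^0 → ⋯ → X^n → 0` with all `X^i ∈ XX`
(a coresolution of length `n`). -/
inductive HasCoresolutionLength (XX : Set C) : ℕ → C → Prop
  | zero {M X : C} (hX : X ∈ XX) (e : M ≅ X) : HasCoresolutionLength XX 0 M
  | succ {n : ℕ} {M : C} (X Q : C) (hX : X ∈ XX)
      (i : M ⟶ X) (p : X ⟶ Q) (hse : IsShortExactSeq i p)
      (hQ : HasCoresolutionLength XX n Q) : HasCoresolutionLength XX (n + 1) M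

/-- The `XX`-coresolution dimension `coresdim_XX(M) : ℕ∞`. -/
noncomputable def coresDim (XX : Set C) (M : C) : ℕ∞ :=
  sInf {m : ℕ∞ | ∃ n : ℕ, m = (n : ℕ∞) ∧ HasCoresolutionLength XX n M}

/-- `XX^∨`, the class of objects with a finite `XX`-coresolution. -/
def coresVee (XX : Set C) : Set C :=
  {M | ∃ n : ℕ, HasCoresolutionLength XX n M}

/-- `IsSyzygyOf XX n M K` : there is an exact sequence
`0 → K → X_{n-1} → ⋯ → X_0 → M → 0` with all `X_i ∈ XX`. -/
inductive IsSyzygyOf (XX : Set C) : ℕ → C → C → Prop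
  | zero {M K : C} (e : K ≅ M) : IsSyzygyOf XX 0 M K
  | succ {n : ℕ} {M : C} (K X L : C) (hX : X ∈ XX)
      (i : K ⟶ X) (p : X ⟶ L) (hse : IsShortExactSeq i p)
      (hL : IsSyzygyOf XX n M L) : IsSyzygyOf XX (n + 1) M K

/-- `XX^⊥ = {N | Ext^i(X, N) = 0 for all X ∈ XX, i > 0}`. -/
def rightPerp (XX : Set C) : Set C :=
  {N | ∀ X ∈ XX, ∀ i : ℕ, 0 < i → Subsingleton (Abelian.Ext.{w} X N i)}

/-- `XX^{⊥₁} = {N | Ext^1(X, N) = 0 for all X ∈ XX}`. -/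
def rightPerp1 (XX : Set C) : Set C :=
  {N | ∀ X ∈ XX, Subsingleton (Abelian.Ext.{w} X N 1)}

/-- `^⊥XX = {N | Ext^i(N, X) = 0 for all X ∈ XX, i > 0}`. -/
def leftPerp (XX : Set C) : Set C :=
  {N | ∀ X ∈ XX, ∀ i : ℕ, 0 < i → Subsingleton (Abelian.Ext.{w} N X i)}

/-- `^{⊥₁}XX = {N | Ext^1(N, X) = 0 for all X ∈ XX}`. -/
def leftPerp1 (XX : Set C) : Set C :=
  {N | ∀ X ∈ XX, Subsingleton (Abelian.Ext.{w} N X 1)}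

/-- Closed under extensions. -/
def ClosedUnderExtensions (XX : Set C) : Prop :=
  ∀ ⦃A B C' : C⦄ (f : A ⟶ B) (g : B ⟶ C'), IsShortExactSeq f g →
    A ∈ XX → C' ∈ XX → B ∈ XX

/-- Closed under kernels of epimorphisms between objects of the class. -/
def ClosedUnderKernelsOfEpis (XX : Set C) : Prop :=
  ∀ ⦃A B C' : C⦄ (f : A ⟶ B) (g : B ⟶ C'), IsShortExactSeq f g →
    B ∈ XX → C' ∈ XX → A ∈ XX

/-- Closed under cokernels of monomorphisms between objects of the class. -/
def ClosedUnderCokernelsOfMonos (XX : Set C) : Prop :=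
  ∀ ⦃A B C' : C⦄ (f : A ⟶ B) (g : B ⟶ C'), IsShortExactSeq f g →
    A ∈ XX → B ∈ XX → C' ∈ XX

/-- Closed under direct summands (retracts) in `C`. -/
def ClosedUnderSummands (XX : Set C) : Prop :=
  ∀ ⦃X A : C⦄, X ∈ XX → ∀ (s : A ⟶ X) (r : X ⟶ A), s ≫ r = 𝟙 A → A ∈ XX

/-- Pre-resolving class: closed under extensions and kernels of epimorphisms. -/
def IsPreresolving (XX : Set C) : Prop :=
  ClosedUnderExtensions XX ∧ ClosedUnderKernelsOfEpis XX

/-- Pre-coresolving class: closed under extensions and cokernels of monomorphisms. -/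
def IsPrecoresolving (XX : Set C) : Prop :=
  ClosedUnderExtensions XX ∧ ClosedUnderCokernelsOfMonos XX

/-- Left thick class. -/
def IsLeftThick (XX : Set C) : Prop :=
  IsPreresolving XX ∧ ClosedUnderSummands XX

/-- Right thick class. -/
def IsRightThick (XX : Set C) : Prop :=
  IsPrecoresolving XX ∧ ClosedUnderSummands XX

/-- Thick class. -/
def IsThickClass (XX : Set C) : Prop :=
  IsLeftThick XX ∧ IsRightThick XX

/-- The smallest thick class of `C` containing `S`. -/
def thickClosure (S : Set C) : Set C :=
  ⋂₀ {T : Set C | IsThickClass T ∧ S ⊆ T}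

/-- The class of projective objects of `C`. -/
def ProjClass (C : Type u) [Category.{v} C] : Set C := {P | Projective P}

/-- The class of injective objects of `C`. -/
def InjClass (C : Type u) [Category.{v} C] : Set C := {I | Injective I}

/-- Resolving class in `C`: pre-resolving and containing all projectives. -/
def IsResolvingClass (XX : Set C) : Prop :=
  IsPreresolving XX ∧ ProjClass C ⊆ XX

/-- Coresolving class in `C`: pre-coresolving and containing all injectives. -/
def IsCoresolvingClass (XX : Set C) : Prop :=
  IsPrecoresolving XX ∧ InjClass C ⊆ XX

/-- A left Frobenius pair `(XX, ωω)` in `C`. -/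
structure LeftFrobeniusPair (XX ωω : Set C) : Prop where
  leftThick : IsLeftThick XX
  relInj : IsRelInjective XX ωω
  relCogen : IsRelCogenerator XX ωω
  summands : ClosedUnderSummands ωω

/-- A strong left Frobenius pair `(XX, ωω)` in `C`. -/
structure StrongLeftFrobeniusPair (XX ωω : Set C) extends LeftFrobeniusPair XX ωω : Prop where
  relProj : IsRelProjective XX ωω
  relGen : IsRelGenerator XX ωω

/-- A right Frobenius pair `(νν, YY)` in `C`. -/
structure RightFrobeniusPair (νν YY : Set C) : Prop where
  rightThick : IsRightThick YY
  relProj : IsRelProjective YY νν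
  relGen : IsRelGenerator YY νν
  summands : ClosedUnderSummands νν

/-- `φ : X ⟶ M` is an `XX`-precover of `M`. -/
def IsPrecover (XX : Set C) {X M : C} (φ : X ⟶ M) : Prop :=
  X ∈ XX ∧ ∀ (X' : C), X' ∈ XX → ∀ f : X' ⟶ M, ∃ h : X' ⟶ X, h ≫ φ = f

/-- `φ : M ⟶ Y` is an `XX`-preenvelope of `M`. -/
def IsPreenvelope (XX : Set C) {M Y : C} (φ : M ⟶ Y) : Prop :=
  Y ∈ XX ∧ ∀ (Y' : C), Y' ∈ XX → ∀ f : M ⟶ Y', ∃ h : Y ⟶ Y', φ ≫ h = f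

/-- A left `S`-cotorsion pair `(F, G)` in `C`. -/
def IsLeftCotorsionPair (S F G : Set C) : Prop :=
  F ⊆ S ∧ G ⊆ S ∧
  F = {A | A ∈ S ∧ ∀ G' ∈ G, Subsingleton (Abelian.Ext.{w} A G' 1)} ∧
  ∀ s ∈ S, ∃ (G' F' : C) (i : G' ⟶ F') (p : F' ⟶ s),
    G' ∈ G ∧ F' ∈ F ∧ IsShortExactSeq i p

/-- A right `S`-cotorsion pair `(F, G)` in `C`. -/
def IsRightCotorsionPair (S F G : Set C) : Prop :=
  F ⊆ S ∧ G ⊆ S ∧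
  G = {A | A ∈ S ∧ ∀ F' ∈ F, Subsingleton (Abelian.Ext.{w} F' A 1)} ∧
  ∀ s ∈ S, ∃ (G' F' : C) (i : s ⟶ G') (p : G' ⟶ F'),
    G' ∈ G ∧ F' ∈ F ∧ IsShortExactSeq i p

/-- An `S`-cotorsion pair `(F, G)` in `C`. -/
def IsCotorsionPair (S F G : Set C) : Prop :=
  IsLeftCotorsionPair S F G ∧ IsRightCotorsionPair S F G

/-- A left weak AB context `(AA, BB)` in `C`. -/
structure LeftWeakABContext (AA BB : Set C) : Prop where
  frob : LeftFrobeniusPair AA (AA ∩ BB)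
  rightThick : IsRightThick BB
  sub : BB ⊆ resHat AA

section ShortExactSequences

variable {D : Type u} [Category.{v} D] [Abelian D]

lemma IsShortExactSeq.of_desc {X Y Z : D} (f : X ⟶ Y) (g : Y ⟶ Z) (w : f ≫ g = 0)
    [Mono f] [Epi g] (h : ∀ {T : D} (k : Y ⟶ T), f ≫ k = 0 → ∃ l : Z ⟶ T, g ≫ l = k) :
    IsShortExactSeq f g := by
  refine ⟨w, ShortComplex.ShortExact.mk' ?_ ‹_› ‹_›⟩
  exact ShortComplex.exact_of_g_is_cokernel _
    (CokernelCofork.IsColimit.ofπ' _ _ fun k hk ↦ ⟨(h k hk).choose, (h k hk).choose_spec⟩)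

lemma IsShortExactSeq.mono {X Y Z : D} {f : X ⟶ Y} {g : Y ⟶ Z} (h : IsShortExactSeq f g) :
    Mono f := by
  obtain ⟨w, h⟩ := h
  exact h.mono_f

lemma IsShortExactSeq.epi {X Y Z : D} {f : X ⟶ Y} {g : Y ⟶ Z} (h : IsShortExactSeq f g) :
    Epi g := by
  obtain ⟨w, h⟩ := h
  exact h.epi_g

lemma IsShortExactSeq.exists_desc {X Y Z T : D} {f : X ⟶ Y} {g : Y ⟶ Z}
    (h : IsShortExactSeq f g) (k : Y ⟶ T) (hk : f ≫ k = 0) : ∃ l : Z ⟶ T, g ≫ l = k := by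
  obtain ⟨w, h⟩ := h
  have := h.epi_g
  exact h.exact.desc' k hk

lemma isShortExactSeq_id_zero (X : D) : IsShortExactSeq (0 : (0 : D) ⟶ X) (𝟙 X) :=
  .of_desc _ _ (by simp) fun k _ ↦ ⟨k, by simp⟩

/-- The pushout of a short exact sequence along a morphism out of its kernel term. -/
lemma IsShortExactSeq.of_isPushout {X Y Z X' Y' : D} {f : X ⟶ Y} {g : Y ⟶ Z}
    (h : IsShortExactSeq f g) {u : X ⟶ X'} {v : Y ⟶ Y'} {f' : X' ⟶ Y'}
    (sq : IsPushout f u v f') : ∃ g' : Y' ⟶ Z, IsShortExactSeq f' g' := by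
  have := h.mono
  have := h.epi
  have hv : v ≫ sq.desc g 0 (by simp [h.1]) = g := sq.inl_desc _ _ _
  have hf : f' ≫ sq.desc g 0 (by simp [h.1]) = 0 := sq.inr_desc _ _ _
  have : Mono f' := (MorphismProperty.monomorphisms D).of_isPushout sq.flip ‹Mono f›
  have : Epi (sq.desc g 0 (by simp [h.1])) := epi_of_epi_fac hv
  refine ⟨_, .of_desc f' _ hf fun {T} k hk ↦ ?_⟩
  obtain ⟨l, hl⟩ := h.exists_desc (v ≫ k) (by rw [← Category.assoc, sq.w, Category.assoc, hk,
    comp_zero])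
  refine ⟨l, sq.hom_ext ?_ ?_⟩
  · rw [← Category.assoc, hv, hl]
  · rw [← Category.assoc, hf, hk, zero_comp]

/-- The pushout of the cokernel of `i` along a monomorphism `j` is a cokernel of `i ≫ j`. -/
lemma IsShortExactSeq.comp_of_isPushout {X Y Z Y' Z' : D} {i : X ⟶ Y} {p : Y ⟶ Z}
    (h : IsShortExactSeq i p) {j : Y ⟶ Y'} [Mono j] {k : Z ⟶ Z'} {r : Y' ⟶ Z'}
    (sq : IsPushout p j k r) : IsShortExactSeq (i ≫ j) r := by
  have := h.mono
  have := h.epi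
  have : Epi r := sq.epi_inr_of_epi
  refine .of_desc _ _ (by rw [Category.assoc, ← sq.w, ← Category.assoc, h.1, zero_comp])
    fun {T} t ht ↦ ?_
  obtain ⟨l, hl⟩ := h.exists_desc (j ≫ t) (by rw [← Category.assoc, ht])
  exact ⟨sq.desc l t hl, sq.inr_desc _ _ _⟩

/-- Auslander–Buchweitz approximations: for `M` in `XX^∧` there are short exact sequences
`0 → K → X → M → 0` and `0 → M → H → X' → 0` with `K, H` in `ωω^∧` and `X, X'` in `XX`. -/
lemma HasResolutionLength.exists_approximations {XX ωω : Set D}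
    (hext : ClosedUnderExtensions XX) (hcogen : IsRelCogenerator XX ωω)
    (hsummands : ClosedUnderSummands ωω) {n : ℕ} {M : D} (hM : HasResolutionLength XX n M) :
    (∃ (K X : D) (i : K ⟶ X) (p : X ⟶ M), K ∈ resHat ωω ∧ X ∈ XX ∧ IsShortExactSeq i p) ∧
    (∃ (H X' : D) (i : M ⟶ H) (p : H ⟶ X'), H ∈ resHat ωω ∧ X' ∈ XX ∧ IsShortExactSeq i p) := by
  induction hM with
  | @zero M X hX e =>
    obtain ⟨W, X', i, p, hW, hX', hip⟩ := hcogen.2 X hX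
    have := hip.mono
    have := hip.epi
    refine ⟨⟨0, X, 0, e.hom, ⟨0, .zero (hsummands hW 0 0 (by simp)) (Iso.refl _)⟩, hX,
      .of_desc _ _ (by simp) fun k _ ↦ ⟨e.inv ≫ k, by simp⟩⟩,
      ⟨W, X', e.inv ≫ i, p, ⟨0, .zero hW (Iso.refl _)⟩, hX',
      .of_desc _ _ (by simp [hip.1]) fun k hk ↦ hip.exists_desc k ?_⟩⟩
    rwa [Category.assoc, Preadditive.IsIso.comp_left_eq_zero] at hk
  | @succ n M K X hX i p hip _ ih =>
    obtain ⟨H, X', q, r, ⟨m, hH⟩, hX', hqr⟩ := ih.2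
    have sq := IsPushout.of_hasPushout i q
    obtain ⟨_, hE⟩ := hqr.of_isPushout sq.flip
    obtain ⟨g, hHE⟩ := hip.of_isPushout sq
    have hEX := hext _ _ hE hX hX'
    refine ⟨⟨H, _, _, _, ⟨m, hH⟩, hEX, hHE⟩, ?_⟩
    obtain ⟨W, X'', j, s, hW, hX'', hjs⟩ := hcogen.2 _ hEX
    have := hjs.mono
    have sq' := IsPushout.of_hasPushout g j
    obtain ⟨_, hQ⟩ := hjs.of_isPushout sq'.flip
    exact ⟨_, X'', _, _, ⟨m + 1, .succ H W hW _ _ (hHE.comp_of_isPushout sq') hH⟩, hX'', hQ⟩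

lemma resHat_mono {XX YY : Set D} (h : XX ⊆ YY) : resHat XX ⊆ resHat YY := by
  rintro M ⟨n, hM⟩
  refine ⟨n, ?_⟩
  induction hM with
  | zero hX e => exact .zero (h hX) e
  | succ K X hX i p hip _ ih => exact .succ K X (h hX) i p hip ih

lemma subset_resHat (XX : Set D) : XX ⊆ resHat XX :=
  fun _ hX ↦ ⟨0, .zero hX (Iso.refl _)⟩

/-- A right thick class is closed under finite resolutions. -/
lemma IsRightThick.resHat_subset {YY : Set D} (h : IsRightThick YY) : resHat YY ⊆ YY := by
  rintro M ⟨n, hM⟩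
  induction hM with
  | zero hX e => exact h.2 hX e.inv e.hom (by simp)
  | succ K X hX i p hip _ ih => exact h.1.2 i p hip ih hX

end ShortExactSequences

/-- A short exact sequence `0 → X → Y → Z → 0` with `Ext^1(Z, X) = 0` splits. -/
lemma IsShortExactSeq.exists_splitting {X Y Z : C} {f : X ⟶ Y} {g : Y ⟶ Z}
    (h : IsShortExactSeq f g) (hext : Subsingleton (Abelian.Ext.{w} Z X 1)) :
    (∃ r : Y ⟶ X, f ≫ r = 𝟙 X) ∧ (∃ s : Z ⟶ Y, s ≫ g = 𝟙 Z) := by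
  obtain ⟨w, h⟩ := h
  constructor
  · obtain ⟨x, hx⟩ := Abelian.Ext.contravariant_sequence_exact₁ h X
      (Abelian.Ext.mk₀.{w} (𝟙 X)) (add_zero 1) (Subsingleton.elim _ _)
    obtain ⟨r, rfl⟩ := Abelian.Ext.addEquiv₀.symm.surjective x
    exact ⟨r, (Abelian.Ext.mk₀_bijective X X).1 (by simpa using hx)⟩
  · obtain ⟨x, hx⟩ := Abelian.Ext.covariant_sequence_exact₃ Z h
      (Abelian.Ext.mk₀.{w} (𝟙 Z)) (zero_add 1) (Subsingleton.elim _ _)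
    obtain ⟨s, rfl⟩ := Abelian.Ext.addEquiv₀.symm.surjective x
    exact ⟨s, (Abelian.Ext.mk₀_bijective Z Z).1 (by simpa using hx)⟩

lemma IsRelInjective.resHat {XX ωω : Set C} (h : IsRelInjective.{w} XX ωω) :
    IsRelInjective.{w} XX (resHat ωω) := by
  rintro M ⟨n, hM⟩ X hX
  induction hM with
  | zero hW e =>
    intro j hj
    have := h _ hW X hX j hj
    refine subsingleton_of_forall_eq 0 fun x ↦ ?_
    have hx : (x.comp (Abelian.Ext.mk₀ e.inv) (add_zero j)).comp (Abelian.Ext.mk₀ e.hom)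
        (add_zero j) = x := by simp
    rw [← hx, Subsingleton.elim (x.comp (Abelian.Ext.mk₀ e.inv) (add_zero j)) 0,
      Abelian.Ext.zero_comp]
  | succ K W hW i p hip _ ih =>
    intro j hj
    obtain ⟨w, hip⟩ := hip
    have := h _ hW X hX j hj
    have := ih (j + 1) j.succ_pos
    refine subsingleton_of_forall_eq 0 fun x ↦ ?_
    obtain ⟨y, rfl⟩ := Abelian.Ext.covariant_sequence_exact₃ X hip x rfl (Subsingleton.elim _ _)
    rw [Subsingleton.elim y 0, Abelian.Ext.zero_comp]

/-- Theorem on left weak AB contexts. Let `(A,B)` be a left weak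
AB context and `ω := A ∩ B`. Then (a) `ω = A ∩ A^⊥` and `ω^∧ = B`; (b) `(A,B)` is an
`A^∧`-cotorsion pair with `id_A(B) = 0`. -/
theorem stmt19 (AA BB : Set C) (hctx : LeftWeakABContext AA BB) :
    (AA ∩ BB = AA ∩ rightPerp AA ∧ resHat (AA ∩ BB) = BB) ∧
    (IsCotorsionPair (resHat AA) AA BB ∧ IsRelInjective AA BB) := by
  obtain ⟨⟨⟨⟨hext, -⟩, hsummands⟩, hinj, hcogen, hωsummands⟩, hBB, hsub⟩ := hctx
  have happrox {M : C} (hM : M ∈ resHat AA) :=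
    hM.choose_spec.exists_approximations hext hcogen hωsummands
  have hωB : resHat (AA ∩ BB) ⊆ BB :=
    (resHat_mono Set.inter_subset_right).trans hBB.resHat_subset
  have hBω : resHat (AA ∩ BB) = BB := by
    refine hωB.antisymm fun M hM ↦ ?_
    obtain ⟨K, X, i, p, hK, hX, hip⟩ := (happrox (hsub hM)).1
    obtain ⟨n, hn⟩ := hK
    exact ⟨n + 1, .succ K X ⟨hX, hBB.1.1 i p hip (hωB ⟨n, hn⟩) hM⟩ i p hip hn⟩
  have hAB : IsRelInjective AA BB := hBω ▸ hinj.resHat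
  refine ⟨⟨?_, hBω⟩, ⟨⟨subset_resHat AA, hsub, ?_, fun M hM ↦ ?_⟩,
    ⟨subset_resHat AA, hsub, ?_, fun M hM ↦ ?_⟩⟩, hAB⟩
  · refine Set.Subset.antisymm (fun W hW ↦ ⟨hW.1, hinj W hW⟩) fun X hX ↦ ?_
    obtain ⟨W, X', i, p, hW, hX', hip⟩ := hcogen.2 X hX.1
    obtain ⟨r, hr⟩ := (hip.exists_splitting (hX.2 X' hX' 1 one_pos)).1
    exact hωsummands hW i r hr
  · refine Set.Subset.antisymm
      (fun X hX ↦ ⟨subset_resHat AA hX, fun M hM ↦ hAB M hM X hX 1 one_pos⟩) fun M hM ↦ ?_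
    obtain ⟨K, X, i, p, hK, hX, hip⟩ := (happrox hM.1).1
    obtain ⟨s, hs⟩ := (hip.exists_splitting (hM.2 K (hωB hK))).2
    exact hsummands hX s p hs
  · obtain ⟨K, X, i, p, hK, hX, hip⟩ := (happrox hM).1
    exact ⟨K, X, i, p, hωB hK, hX, hip⟩
  · refine Set.Subset.antisymm
      (fun M hM ↦ ⟨hsub hM, fun X hX ↦ hAB M hM X hX 1 one_pos⟩) fun M hM ↦ ?_
    obtain ⟨H, X, i, p, hH, hX, hip⟩ := (happrox hM.1).2
    obtain ⟨r, hr⟩ := (hip.exists_splitting (hM.2 X hX)).1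
    exact hBB.2 (hωB hH) i r hr
  · obtain ⟨H, X, i, p, hH, hX, hip⟩ := (happrox hM).2
    exact ⟨H, X, i, p, hωB hH, hX, hip⟩

end ABFormal
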